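/- Let u and v be nonempty words over the positive integers such that the concatenation u ++ v contains no four consecutive equal symbols and no two adjacent symbols of u ++ v both exceed 3. If C^k(u ++ v) = C^k(u) ++ C^k(v) for all 0 ≤ k ≤ 9, then C^n(u ++ v) = C^n(u) ++ C^n(v) for all n ≥ 0. (Splitting Theorem: nine derivations suffice to certify a splitting.) -/

import Mathlib

/-- The look-and-say (audioactive) derivation: replace each maximal run of
`k` consecutive equal symbols `a` in the word by the two symbols `k, a`. -/
def lookAndSay (x : List ℕ+) : List ℕ+ :=
  (x.splitBy (· == ·)).flatMap fun r => [r.length.toPNat', r.headD 1]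
def LSD (op : Bool) : List ℕ → List ℕ
  | [] => []
  | [a] => if op && a != 4 then [] else [1, a]
  | [a, b] => if a = b then (if op then [] else [2, a]) else
      1 :: a :: LSD op [b]
  | a :: b :: c :: l =>
      if a = b then (if b = c then 3 :: a :: LSD op l else 2 :: a :: LSD op (c :: l))
      else 1 :: a :: LSD op (b :: c :: l)

def LSV : List ℕ → Bool
  | [] => true
  | a :: l => (1 ≤ a && a ≤ 4) && (l.take 3 != [a, a, a]) && (a != 4 || l.headD 0 != 4) && LSV l

/-- Certificates for the `1, 1, 3` cycle of first letters. -/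
def LSG (op : Bool) : List ℕ → Bool
  | [1, x] => !op && x != 1
  | 1 :: x :: y :: _ => (x != 1 && y != x) || (x == 1 && y == 1)
  | [3, x] => !op && x != 3
  | [3, x, y] => x != 3 && (!op || y != x)
  | 3 :: x :: y :: z :: _ => x != 3 && (y != x || z != x)
  | _ => false

def LSQ (op : Bool) : List ℕ → Bool
  | [2, 2] => !op
  | 2 :: 2 :: l => LSG op l
  | _ => false

def LSok (op : Bool) : ℕ → List ℕ → List ℕ → Bool
  | _, _, [] => false
  | j, S, h :: q =>
    (LSG op (h :: q) && (2 ≤ j || ((1 ∈ h :: S) && (3 ∈ h :: S)))) || LSQ op (h :: q) ||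
    match j with
    | 0 => false
    | j' + 1 => LSok op j' (h :: S) (LSD op (h :: q))

def LSchk : ℕ → List ℕ → Bool
  | 0, _ => false
  | n + 1, p => LSok true 8 [] p ||
    ((p.isEmpty || LSok false 8 [] p) &&
      [1, 2, 3, 4].all fun a => !LSV (p ++ [a]) || LSchk n (p ++ [a]))

theorem LSchk_true : LSchk 16 [] = true := by decide +kernel

/-! ### The finite model over the alphabet `{1, 2, 3, 4}` -/

theorem LSD_one {a : ℕ} {t : List ℕ} (h : t.head? ≠ some a) :
    LSD false (a :: t) = 1 :: a :: LSD false t := by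
  rcases t with _ | ⟨b, _ | ⟨c, t⟩⟩
  · simp [LSD]
  · have : a ≠ b := by rintro rfl; simp at h
    simp [LSD, this]
  · have : a ≠ b := by rintro rfl; simp at h
    rw [LSD]; simp [this]

theorem LSD_two {a : ℕ} {t : List ℕ} (h : t.head? ≠ some a) :
    LSD false (a :: a :: t) = 2 :: a :: LSD false t := by
  rcases t with _ | ⟨b, t⟩
  · simp [LSD]
  · have : a ≠ b := by rintro rfl; simp at h
    rw [LSD]; simp [this]

theorem LSD_three {a : ℕ} {t : List ℕ} :
    LSD false (a :: a :: a :: t) = 3 :: a :: LSD false t := by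
  rw [LSD]; simp

theorem LSV_cons {a : ℕ} {l : List ℕ} : LSV (a :: l) = true ↔
    1 ≤ a ∧ a ≤ 4 ∧ l.take 3 ≠ [a, a, a] ∧ (a = 4 → l.headD 0 ≠ 4) ∧ LSV l = true := by
  simp only [LSV, Bool.and_eq_true, decide_eq_true_eq, bne_iff_ne, Bool.or_eq_true, ne_eq]
  tauto

/-- Decomposition of a nonempty valid word into its first run and the rest. -/
theorem LSV_cases {w : List ℕ} (hV : LSV w = true) (hw : w ≠ []) :
    ∃ k a t, (1 ≤ k ∧ k ≤ 3) ∧ (1 ≤ a ∧ a ≤ 4) ∧ w = List.replicate k a ++ t ∧ t.head? ≠ some a ∧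
      LSV t = true ∧ (a = 4 → t.head? ≠ some 4) ∧ LSD false w = k :: a :: LSD false t := by
  rcases w with _ | ⟨a, w⟩
  · exact absurd rfl hw
  obtain ⟨h1, h2, h3, h4, h5⟩ := LSV_cons.1 hV
  by_cases hb : w.head? = some a
  · rcases w with _ | ⟨b, w⟩
    · simp at hb
    simp only [List.head?_cons, Option.some.injEq] at hb
    subst hb
    obtain ⟨-, -, k3, k4, k5⟩ := LSV_cons.1 h5
    by_cases hc : w.head? = some b
    · rcases w with _ | ⟨c, w⟩
      · simp at hc
      simp only [List.head?_cons, Option.some.injEq] at hc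
      subst hc
      have hw : w.head? ≠ some c := by
        rcases w with _ | ⟨d, w⟩
        · simp
        · simpa using h3
      refine ⟨3, c, w, by omega, by omega, rfl, hw, (LSV_cons.1 k5).2.2.2.2, ?_, LSD_three⟩
      rintro rfl; exact hw
    · refine ⟨2, b, w, by omega, by omega, rfl, hc, k5, ?_, LSD_two hc⟩
      rintro rfl; exact hc
  · refine ⟨1, a, w, by omega, by omega, rfl, hb, h5, ?_, LSD_one hb⟩
    rintro rfl; exact hb

theorem LSD_head_le {w : List ℕ} (hV : LSV w = true) : (LSD false w).headD 0 ≤ 3 := by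
  by_cases hw : w = []
  · subst hw; simp [LSD]
  · obtain ⟨k, a, t, hk, ha, -, -, -, -, hD⟩ := LSV_cases hV hw
    simp [hD]; omega

theorem LSV_D_aux (n : ℕ) : ∀ w : List ℕ, w.length ≤ n → LSV w = true →
    LSV (LSD false w) = true := by
  induction n with
  | zero => intro w hw _; simp at hw; subst hw; simp [LSD, LSV]
  | succ n ih =>
    intro w hl hV
    by_cases hw : w = []
    · subst hw; simp [LSD, LSV]
    obtain ⟨k, a, t, hk, ha, hwt, hta, hVt, -, hD⟩ := LSV_cases hV hw
    have hlt : t.length ≤ n := by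
      have := congrArg List.length hwt
      simp at this; omega
    have iht := ih t hlt hVt
    have hhd := LSD_head_le hVt
    rw [hD, LSV_cons, LSV_cons]
    by_cases ht : t = []
    · subst ht
      simp [LSD, LSV]; omega
    obtain ⟨k', a', t', hk', ha', hwt', hta', hVt', -, hD'⟩ := LSV_cases hVt ht
    have hne : a' ≠ a := by
      rintro rfl
      apply hta
      rw [hwt']
      obtain ⟨m, rfl⟩ : ∃ m, k' = m + 1 := ⟨k' - 1, by omega⟩
      simp [List.replicate_succ]
    rw [hD'] at iht ⊢
    refine ⟨hk.1, by omega, ?_, by omega, ha.1, ha.2, ?_, ?_, iht⟩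
    · simp only [List.take_succ_cons, ne_eq, List.cons.injEq, not_and]
      intro e1 _ e2; omega
    · simp only [List.take_succ_cons, ne_eq, List.cons.injEq, not_and]
      intro _ e2; omega
    · intro _; simp; omega

theorem LSV_D {w : List ℕ} (hV : LSV w = true) : LSV (LSD false w) = true :=
  LSV_D_aux _ w le_rfl hV

theorem LSD_ne_nil {w : List ℕ} (hV : LSV w = true) (hw : w ≠ []) : LSD false w ≠ [] := by
  obtain ⟨k, a, t, -, -, -, -, -, -, hD⟩ := LSV_cases hV hw
  simp [hD]

theorem LSV_append_left {p t : List ℕ} (h : LSV (p ++ t) = true) : LSV p = true := by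
  induction p with
  | nil => simp [LSV]
  | cons a p ih =>
    rw [List.cons_append, LSV_cons] at h
    obtain ⟨h1, h2, h3, h4, h5⟩ := h
    refine LSV_cons.2 ⟨h1, h2, ?_, ?_, ih h5⟩
    · intro h; apply h3
      have hl := congrArg List.length h
      simp at hl
      rw [List.take_append_of_le_length hl, h]
    · intro ha
      rcases p with _ | ⟨b, p⟩
      · simp
      · simpa using h4 ha

/-- The open derivation of a prefix is a prefix of the derivation. -/
theorem LSD_open (p t : List ℕ) (h : LSV (p ++ t) = true) :
    LSD true p <+: LSD false (p ++ t) := by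
  fun_induction LSD true p with
  | case1 => simp
  | case2 a ha => simp
  | case3 a ha =>
    simp at ha; subst ha
    have : t.head? ≠ some 4 := by
      rcases t with _ | ⟨b, t⟩
      · simp
      · simp [LSV_cons] at h; simpa using h.2.1
    rw [List.singleton_append, LSD_one this]
    exact ⟨LSD false t, rfl⟩
  | case4 a => simp
  | case5 => simp_all
  | case6 a b hab ih =>
    have h' := (LSV_cons.1 h).2.2.2.2
    rw [List.cons_append, LSD_one (by simpa using Ne.symm hab)]
    simpa using ih h'
  | case7 b l ih =>
    simp only [List.cons_append] at h ⊢
    rw [LSD_three]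
    have h' := (LSV_cons.1 (LSV_cons.1 (LSV_cons.1 h).2.2.2.2).2.2.2.2).2.2.2.2
    simpa using ih h'
  | case8 b c l hab ih =>
    have h' := (LSV_cons.1 (LSV_cons.1 h).2.2.2.2).2.2.2.2
    simp only [List.cons_append] at h ⊢
    rw [LSD_two (by simpa using Ne.symm hab)]
    simpa using ih h'
  | case9 a b c l hab ih =>
    have htail := (LSV_cons.1 h).2.2.2.2
    rw [List.cons_append, LSD_one (by simpa using Ne.symm hab)]
    simpa using ih htail

/-- The cycle. -/
def LSP1 (w : List ℕ) : Prop := ∃ x t, w = 1 :: x :: t ∧ x ≠ 1 ∧ t.head? ≠ some x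
def LSP2 (w : List ℕ) : Prop := ∃ t, w = 1 :: 1 :: 1 :: t
def LSP3 (w : List ℕ) : Prop := ∃ x t, w = 3 :: x :: t ∧ x ≠ 3 ∧ t.take 2 ≠ [x, x]

theorem LSP1_next {w : List ℕ} (h : LSP1 w) : LSP2 (LSD false w) := by
  obtain ⟨x, t, rfl, hx, ht⟩ := h
  rw [LSD_one (by simpa using hx), LSD_one ht]
  exact ⟨_, rfl⟩

theorem LSP2_next {w : List ℕ} (h : LSP2 w) (hV : LSV w = true) : LSP3 (LSD false w) := by
  obtain ⟨t, rfl⟩ := h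
  rw [LSD_three]
  refine ⟨_, _, rfl, by omega, ?_⟩
  have hta : t.head? ≠ some 1 := by
    have := (LSV_cons.1 hV).2.2.1
    rcases t with _ | ⟨d, w⟩
    · simp
    · simpa using this
  have hVt := (LSV_cons.1 (LSV_cons.1 (LSV_cons.1 hV).2.2.2.2).2.2.2.2).2.2.2.2
  by_cases ht : t = []
  · subst ht; simp [LSD]
  obtain ⟨k', a', t', hk', ha', hwt', hta', hVt', -, hD'⟩ := LSV_cases hVt ht
  have hne : a' ≠ 1 := by
    rintro rfl
    apply hta
    rw [hwt']
    obtain ⟨m, rfl⟩ : ∃ m, k' = m + 1 := ⟨k' - 1, by omega⟩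
    simp [List.replicate_succ]
  rw [hD']
  simp [hne]

theorem LSP3_next {w : List ℕ} (h : LSP3 w) (hV : LSV w = true) : LSP1 (LSD false w) := by
  obtain ⟨x, t, rfl, hx, ht⟩ := h
  rw [LSD_one (by simpa using hx)]
  refine ⟨_, _, rfl, by omega, ?_⟩
  have hVt := (LSV_cons.1 hV).2.2.2.2
  obtain ⟨k', a', t', hk', ha', hwt', hta', hVt', -, hD'⟩ := LSV_cases hVt (by simp)
  rw [hD']
  simp only [List.head?_cons, ne_eq, Option.some.injEq]
  rintro rfl
  simp [List.replicate_succ] at hwt'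
  obtain ⟨rfl, rfl⟩ := hwt'
  simp at ht

def LSPG (w : List ℕ) : Prop := LSP1 w ∨ LSP2 w ∨ LSP3 w
def LSPQ (w : List ℕ) : Prop := ∃ t, w = 2 :: 2 :: t ∧ (t = [] ∨ LSPG t)

theorem LSPG_next {w : List ℕ} (h : LSPG w) (hV : LSV w = true) : LSPG (LSD false w) := by
  rcases h with h | h | h
  · exact .inr (.inl (LSP1_next h))
  · exact .inr (.inr (LSP2_next h hV))
  · exact .inl (LSP3_next h hV)

theorem LSPG_head {w : List ℕ} (h : LSPG w) : w.headD 0 = 1 ∨ w.headD 0 = 3 := by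
  rcases h with ⟨_, _, rfl, _⟩ | ⟨_, rfl⟩ | ⟨_, _, rfl, _⟩ <;> simp

theorem LSPQ_next {w : List ℕ} (h : LSPQ w) (hV : LSV w = true) : LSPQ (LSD false w) := by
  obtain ⟨t, rfl, h⟩ := h
  have ht : t.head? ≠ some 2 := by
    rcases h with rfl | h
    · simp
    · have := LSPG_head h
      rcases t with _ | ⟨b, t⟩ <;> simp at this ⊢; omega
  rw [LSD_two ht]
  refine ⟨_, rfl, ?_⟩
  rcases h with rfl | h
  · simp [LSD]
  · exact .inr (LSPG_next h (LSV_cons.1 (LSV_cons.1 hV).2.2.2.2).2.2.2.2)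

theorem LSPG_iter (n : ℕ) : ∀ {w : List ℕ}, LSPG w → LSV w = true →
    ((LSD false)^[n] w).headD 0 = 1 ∨ ((LSD false)^[n] w).headD 0 = 3 := by
  induction n with
  | zero => intro w h _; exact LSPG_head h
  | succ n ih => intro w h hV; rw [Function.iterate_succ_apply]; exact ih (LSPG_next h hV) (LSV_D hV)

theorem LSPQ_iter (n : ℕ) : ∀ {w : List ℕ}, LSPQ w → LSV w = true →
    ((LSD false)^[n] w).headD 0 = 2 := by
  induction n with
  | zero => rintro w ⟨t, rfl, _⟩ _; simp
  | succ n ih => intro w h hV; rw [Function.iterate_succ_apply]; exact ih (LSPQ_next h hV) (LSV_D hV)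

theorem LSPG_sees {w : List ℕ} (h : LSPG w) (hV : LSV w = true) {l : ℕ} (hl : l = 1 ∨ l = 3) :
    ∃ k ≤ 2, ((LSD false)^[k] w).headD 0 = l := by
  have h1 : ∀ {w}, LSP1 w → w.headD 0 = 1 := by rintro w ⟨_, _, rfl, _⟩; rfl
  have h2 : ∀ {w}, LSP2 w → w.headD 0 = 1 := by rintro w ⟨_, rfl⟩; rfl
  have h3 : ∀ {w}, LSP3 w → w.headD 0 = 3 := by rintro w ⟨_, _, rfl, _⟩; rfl
  have hV1 := LSV_D hV
  rcases h with h | h | h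
  · have a := LSP1_next h
    have b := LSP2_next a hV1
    rcases hl with rfl | rfl
    · exact ⟨0, by omega, h1 h⟩
    · exact ⟨2, by omega, h3 b⟩
  · have a := LSP2_next h hV
    rcases hl with rfl | rfl
    · exact ⟨0, by omega, h2 h⟩
    · exact ⟨1, by omega, h3 a⟩
  · have a := LSP3_next h hV
    rcases hl with rfl | rfl
    · exact ⟨1, by omega, h1 a⟩
    · exact ⟨0, by omega, h3 h⟩

/-- `q` describes `w`: exactly if closed, as a prefix if open. -/
def LSrel (op : Bool) (q w : List ℕ) : Prop := ∃ t, w = q ++ t ∧ (op = false → t = [])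

theorem LSrel_D {op : Bool} {q w : List ℕ} (h : LSrel op q w) (hV : LSV w = true) :
    LSrel op (LSD op q) (LSD false w) := by
  obtain ⟨t, rfl, ht⟩ := h
  cases op with
  | false => simp at ht; subst ht; exact ⟨[], by simp, by simp⟩
  | true =>
    obtain ⟨s, hs⟩ := LSD_open q t hV
    exact ⟨s, hs.symm, by simp⟩

theorem LSG_sound {op : Bool} {q w : List ℕ} (h : LSrel op q w) (hG : LSG op q = true) :
    LSPG w := by
  obtain ⟨t, rfl, ht⟩ := h
  unfold LSG at hG
  split at hG
  · simp at hG
    simp [ht hG.1]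
    exact .inl ⟨_, _, rfl, hG.2, by simp⟩
  · simp at hG
    rcases hG with hG | ⟨rfl, rfl⟩
    · exact .inl ⟨_, _, rfl, hG.1, by simpa using hG.2⟩
    · exact .inr (.inl ⟨_, rfl⟩)
  · simp at hG
    simp [ht hG.1]
    exact .inr (.inr ⟨_, _, rfl, hG.2, by simp⟩)
  · simp at hG
    refine .inr (.inr ⟨_, _, rfl, hG.1, ?_⟩)
    rcases hG.2 with h | h
    · simp [ht h]
    · simp [h]
  · simp at hG
    refine .inr (.inr ⟨_, _, rfl, hG.1, ?_⟩)
    simp; tauto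
  · simp at hG

theorem LSQ_sound {op : Bool} {q w : List ℕ} (h : LSrel op q w) (hQ : LSQ op q = true) :
    LSPQ w := by
  obtain ⟨t, rfl, ht⟩ := h
  unfold LSQ at hQ
  split at hQ
  · simp at hQ
    exact ⟨_, rfl, .inl (ht hQ)⟩
  · exact ⟨_, rfl, .inr (LSG_sound ⟨t, rfl, ht⟩ hQ)⟩
  · simp at hQ

/-- First letters not seen within `j` steps are never seen. -/
def LSGood (j : ℕ) (S w : List ℕ) : Prop := ∀ l : ℕ, 1 ≤ l → l ≤ 3 → l ∉ S →
  (∀ k ≤ j, ((LSD false)^[k] w).headD 0 ≠ l) → ∀ n, ((LSD false)^[n] w).headD 0 ≠ l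

theorem LSok_sound {op : Bool} (j : ℕ) : ∀ {S q w : List ℕ}, LSrel op q w → LSV w = true →
    LSok op j S q = true → LSGood j S w := by
  induction j with
  | zero =>
    intro S q w hr hV hok
    rcases q with _ | ⟨h, q⟩
    · simp [LSok] at hok
    have hhd : w.headD 0 = h := by obtain ⟨t, rfl, _⟩ := hr; rfl
    simp only [LSok, Bool.or_eq_true, Bool.and_eq_true, decide_eq_true_eq] at hok
    intro l hl1 hl3 hlS hk n hn
    have h0 := hk 0 le_rfl
    simp only [Function.iterate_zero, id_eq] at h0
    rcases hok with (⟨hG, hj⟩ | hQ) | hF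
    · have hlh : l ∉ h :: S := by simp; exact ⟨by omega, hlS⟩
      have := LSPG_iter n (LSG_sound hr hG) hV
      rw [hn] at this
      rcases hj with hj | hj
      · omega
      · rcases this with rfl | rfl
        · exact hlh hj.1
        · exact hlh hj.2
    · have := LSPQ_iter n (LSQ_sound hr hQ) hV
      have h2 := LSPQ_iter 0 (LSQ_sound hr hQ) hV
      simp only [Function.iterate_zero, id_eq] at h2
      omega
    · simp at hF
  | succ j ih =>
    intro S q w hr hV hok
    rcases q with _ | ⟨h, q⟩
    · simp [LSok] at hok
    have hhd : w.headD 0 = h := by obtain ⟨t, rfl, _⟩ := hr; rfl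
    simp only [LSok, Bool.or_eq_true, Bool.and_eq_true, decide_eq_true_eq] at hok
    intro l hl1 hl3 hlS hk n hn
    have h0 := hk 0 (by omega)
    simp only [Function.iterate_zero, id_eq] at h0
    have hlh : l ∉ h :: S := by simp; exact ⟨by omega, hlS⟩
    rcases hok with (⟨hG, hj⟩ | hQ) | hF
    · have hg := LSG_sound hr hG
      have := LSPG_iter n hg hV
      rw [hn] at this
      rcases hj with hj | hj
      · obtain ⟨k, hk2, hkl⟩ := LSPG_sees hg hV this
        exact hk k (by omega) hkl
      · rcases this with rfl | rfl
        · exact hlh hj.1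
        · exact hlh hj.2
    · have := LSPQ_iter n (LSQ_sound hr hQ) hV
      have h2 := LSPQ_iter 0 (LSQ_sound hr hQ) hV
      simp only [Function.iterate_zero, id_eq] at h2
      omega
    · rcases n with _ | n
      · exact hk 0 (by omega) hn
      · refine ih (LSrel_D hr hV) (LSV_D hV) hF l hl1 hl3 hlh ?_ n ?_
        · intro k hkj
          exact hk (k + 1) (by omega)
        · exact hn

theorem LSchk_sound (n : ℕ) : ∀ (p t : List ℕ), LSchk n p = true → LSV (p ++ t) = true →
    p ++ t ≠ [] → LSGood 8 [] (p ++ t) := by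
  induction n with
  | zero => intro p t h; simp [LSchk] at h
  | succ n ih =>
    intro p t h hV hne
    rw [LSchk, Bool.or_eq_true, Bool.and_eq_true] at h
    rcases h with h | ⟨h1, h2⟩
    · exact LSok_sound 8 ⟨t, rfl, by simp⟩ hV h
    · rcases t with _ | ⟨a, t⟩
      · simp only [List.append_nil] at hV hne ⊢
        rw [Bool.or_eq_true] at h1
        rcases h1 with h1 | h1
        · simp at h1; exact absurd h1 hne
        · exact LSok_sound 8 ⟨[], by simp, by simp⟩ hV h1
      · have e : p ++ a :: t = (p ++ [a]) ++ t := by simp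
        rw [e] at hV hne ⊢
        have hVa := LSV_append_left hV
        have ha : 1 ≤ a ∧ a ≤ 4 := by
          clear * - hVa
          induction p with
          | nil => have := LSV_cons.1 hVa; exact ⟨this.1, this.2.1⟩
          | cons b p ih => exact ih (LSV_cons.1 hVa).2.2.2.2
        rw [List.all_eq_true] at h2
        have := h2 a (by simp; omega)
        rw [hVa] at this
        exact ih _ _ (by simpa using this) hV hne

theorem LS_main (w : List ℕ) (hV : LSV w = true) (hw : w ≠ []) : LSGood 8 [] w :=
  LSchk_sound 16 [] w LSchk_true hV hw

/-! ### The derivation on words over the positive integers -/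

theorem lookAndSay_append {x y : List ℕ+} (h : ∀ a ∈ x.getLast?, ∀ b ∈ y.head?, a ≠ b) :
    lookAndSay (x ++ y) = lookAndSay x ++ lookAndSay y := by
  unfold lookAndSay
  rw [List.splitBy_append, List.flatMap_append]
  intro a ha b hb
  simpa using h a ha b hb

theorem lookAndSay_replicate (k : ℕ) (a : ℕ+) :
    lookAndSay (List.replicate (k + 1) a) = [(k + 1).toPNat', a] := by
  unfold lookAndSay
  rw [List.splitBy_of_isChain (by simp)]
  · simp [List.replicate_succ]
  · exact List.isChain_replicate_of_rel _ (by simp)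

theorem lookAndSay_run {k : ℕ} {a : ℕ+} {t : List ℕ+} (h : t.head? ≠ some a) :
    lookAndSay (List.replicate (k + 1) a ++ t) = (k + 1).toPNat' :: a :: lookAndSay t := by
  rw [lookAndSay_append, lookAndSay_replicate]
  · rfl
  · intro b hb c hc hbc
    simp [List.getLast?_replicate] at hb
    subst hb; subst hbc
    exact h hc

theorem run_cases (w : List ℕ+) (hw : w ≠ []) :
    ∃ k a t, w = List.replicate (k + 1) a ++ t ∧ t.head? ≠ some a := by
  induction w with
  | nil => exact absurd rfl hw
  | cons a w ih =>
    by_cases hb : w.head? = some a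
    · obtain ⟨k, b, t, rfl, h⟩ := ih (by rintro rfl; simp at hb)
      simp [List.replicate_succ] at hb
      subst hb
      exact ⟨k + 1, b, t, rfl, h⟩
    · exact ⟨0, a, w, rfl, hb⟩

theorem lookAndSay_nil : lookAndSay [] = [] := rfl

theorem lookAndSay_ne_nil {w : List ℕ+} (hw : w ≠ []) : lookAndSay w ≠ [] := by
  obtain ⟨k, a, t, rfl, h⟩ := run_cases w hw
  simp [lookAndSay_run h]

theorem lookAndSay_getLast_aux (n : ℕ) : ∀ w : List ℕ+, w.length ≤ n →
    (lookAndSay w).getLast? = w.getLast? := by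
  induction n with
  | zero => intro w hw; simp at hw; subst hw; rfl
  | succ n ih =>
    intro w hl
    by_cases hw : w = []
    · subst hw; rfl
    obtain ⟨k, a, t, rfl, h⟩ := run_cases w hw
    simp at hl
    rw [lookAndSay_run h]
    by_cases ht : t = []
    · subst ht; simp [lookAndSay_nil, List.getLast?_replicate]
    · have h1 := ih t (by omega)
      have h2 := lookAndSay_ne_nil ht
      rw [List.getLast?_append_of_ne_nil _ ht, ← h1]
      obtain ⟨b, s, hs⟩ := List.exists_cons_of_ne_nil h2
      simp [hs]

theorem lookAndSay_getLast (w : List ℕ+) : (lookAndSay w).getLast? = w.getLast? :=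
  lookAndSay_getLast_aux _ w le_rfl

theorem lookAndSay_merge_aux (n : ℕ) : ∀ (x : List ℕ+) (a : ℕ+) (y : List ℕ+), x.length ≤ n →
    x.getLast? = some a → y.head? = some a →
    (lookAndSay (x ++ y)).length < (lookAndSay x).length + (lookAndSay y).length := by
  induction n with
  | zero => intro x a y hx h; simp at hx; subst hx; simp at h
  | succ n ih =>
    intro x a y hl hx hy
    obtain ⟨k, b, t, rfl, h⟩ := run_cases x (by rintro rfl; simp at hx)
    by_cases ht : t = []
    · subst ht
      simp [List.getLast?_replicate] at hx
      subst hx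
      obtain ⟨j, c, s, rfl, hs⟩ := run_cases y (by rintro rfl; simp at hy)
      simp [List.replicate_succ] at hy
      subst hy
      have e : List.replicate (k + 1) c ++ [] ++ (List.replicate (j + 1) c ++ s) =
          List.replicate ((k + 1 + j) + 1) c ++ s := by
        rw [List.append_nil, ← List.append_assoc, List.replicate_append_replicate]; rfl
      rw [e, lookAndSay_run hs, lookAndSay_run hs, lookAndSay_run h]
      simp [lookAndSay_nil]
    · rw [List.getLast?_append_of_ne_nil _ ht] at hx
      simp at hl
      have := ih t a y (by omega) hx hy
      have h' : (t ++ y).head? ≠ some b := by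
        obtain ⟨c, s, rfl⟩ := List.exists_cons_of_ne_nil ht
        simpa using h
      rw [List.append_assoc, lookAndSay_run h, lookAndSay_run h']
      simp; omega

theorem lookAndSay_merge {x y : List ℕ+} {a : ℕ+} (hx : x.getLast? = some a)
    (hy : y.head? = some a) : lookAndSay (x ++ y) ≠ lookAndSay x ++ lookAndSay y := by
  intro h
  have := lookAndSay_merge_aux _ x a y le_rfl hx hy
  rw [h] at this
  simp at this

/-- Truncation to the alphabet `{1, 2, 3, 4}`. -/
def LSg (a : ℕ+) : ℕ := min (a : ℕ) 4

theorem LSg_inj {a b : ℕ+} (h : LSg a = LSg b) (h4 : LSg a ≠ 4) : a = b := by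
  apply PNat.eq
  unfold LSg at h h4
  omega

theorem LSbridge_aux (n : ℕ) : ∀ w : List ℕ+, w.length ≤ n → LSV (w.map LSg) = true →
    (lookAndSay w).map LSg = LSD false (w.map LSg) := by
  induction n with
  | zero => intro w hw _; simp at hw; subst hw; simp [lookAndSay_nil, LSD]
  | succ n ih =>
    intro w hl hV
    by_cases hw : w = []
    · subst hw; simp [lookAndSay_nil, LSD]
    obtain ⟨k, a, t, hk, ha, hwt, hta, hVt, ha4, hD⟩ := LSV_cases hV (by simpa using hw)
    obtain ⟨k', b, s, rfl, hs⟩ := run_cases w hw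
    simp only [List.length_append, List.length_replicate] at hl
    -- identify the two decompositions
    have hbs : (s.map LSg).head? ≠ some (LSg b) := by
      rcases s with _ | ⟨c, s⟩
      · simp
      simp only [List.map_cons, List.head?_cons, ne_eq, Option.some.injEq] at hs ⊢
      intro hc
      by_cases h4 : LSg c = 4
      · have hb : LSg b = 4 := by omega
        have hh : LSV (LSg b :: LSg c :: s.map LSg) = true := by
          clear * - hV
          induction k' with
          | zero => simpa using hV
          | succ k ih =>
            rw [List.replicate_succ, List.cons_append, List.map_cons] at hV
            exact ih (LSV_cons.1 hV).2.2.2.2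
        have := (LSV_cons.1 hh).2.2.2.1 hb
        simp [h4] at this
      · exact hs (LSg_inj hc h4)
    rw [List.map_append, List.map_replicate] at hwt
    have key : ∀ (m m' : ℕ) (x y : ℕ) (p q : List ℕ), p.head? ≠ some x → q.head? ≠ some y →
        List.replicate (m + 1) x ++ p = List.replicate (m' + 1) y ++ q → m = m' ∧ x = y ∧ p = q := by
      intro m
      induction m with
      | zero =>
        intro m' x y p q hp hq e
        simp [List.replicate_succ] at e
        obtain ⟨rfl, rfl⟩ := e
        cases m' with
        | zero => simp
        | succ m' => simp [List.replicate_succ] at hp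
      | succ m ihm =>
        intro m' x y p q hp hq e
        cases m' with
        | zero =>
          simp [List.replicate_succ] at e
          obtain ⟨rfl, rfl⟩ := e
          simp at hq
        | succ m' =>
          rw [List.replicate_succ, List.replicate_succ (n := m' + 1), List.cons_append,
            List.cons_append, List.cons.injEq] at e
          have := ihm m' x y p q hp hq e.2
          exact ⟨by omega, this.2⟩
    obtain ⟨m, rfl⟩ : ∃ m, k = m + 1 := ⟨k - 1, by omega⟩
    obtain ⟨rfl, rfl, rfl⟩ := key _ _ _ _ _ _ hbs hta hwt
    rw [hD, lookAndSay_run hs, List.map_cons, List.map_cons, ih s (by omega) hVt]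
    congr 1
    simp [LSg, Nat.toPNat'_coe]; omega

theorem LSbridge {w : List ℕ+} (hV : LSV (w.map LSg) = true) :
    (lookAndSay w).map LSg = LSD false (w.map LSg) := LSbridge_aux _ w le_rfl hV

theorem LSbridge_iter {w : List ℕ+} (hV : LSV (w.map LSg) = true) (n : ℕ) :
    (lookAndSay^[n] w).map LSg = (LSD false)^[n] (w.map LSg) ∧
      LSV ((lookAndSay^[n] w).map LSg) = true := by
  induction n with
  | zero => exact ⟨rfl, hV⟩
  | succ n ih =>
    rw [Function.iterate_succ_apply', Function.iterate_succ_apply', ← ih.1, LSbridge ih.2]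
    exact ⟨rfl, LSV_D ih.2⟩

theorem LSV_of_hyp (v : List ℕ+) (h4 : ∀ a : ℕ+, ¬ [a, a, a, a] <:+: v)
    (hbig : ∀ a b : ℕ+, [a, b] <:+: v → a ≤ 3 ∨ b ≤ 3) : LSV (v.map LSg) = true := by
  induction v with
  | nil => rfl
  | cons a v ih =>
    have ihv := ih (fun a h => h4 a (h.trans (List.suffix_cons _ _).isInfix))
      (fun a b h => hbig a b (h.trans (List.suffix_cons _ _).isInfix))
    have hbig' : ∀ b s, v = b :: s → LSg a = 4 → LSg b ≠ 4 := by
      rintro b s rfl h h'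
      have := hbig a b ⟨[], s, by simp⟩
      rw [← PNat.coe_le_coe, ← PNat.coe_le_coe] at this
      unfold LSg at h h'
      simp at h h' this
      omega
    rw [List.map_cons, LSV_cons]
    refine ⟨?_, ?_, ?_, ?_, ihv⟩
    · have := a.pos; unfold LSg; omega
    · unfold LSg; omega
    · rcases v with _ | ⟨b, _ | ⟨c, _ | ⟨d, s⟩⟩⟩
      · simp
      · simp
      · simp
      · simp only [List.map_cons, List.take_succ_cons, List.take_zero, ne_eq, List.cons.injEq,
          and_true]
        rintro ⟨e1, e2, e3⟩
        have hn : LSg a ≠ 4 := fun h => hbig' b _ rfl h (by omega)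
        have e1 := LSg_inj e1.symm hn
        have e2 := LSg_inj e2.symm hn
        have e3 := LSg_inj e3.symm hn
        subst e1 e2 e3
        exact h4 a ⟨[], s, by simp⟩
    · intro h
      rcases v with _ | ⟨b, s⟩
      · simp
      · simpa using hbig' b s rfl h

theorem lookAndSay_iter_getLast (w : List ℕ+) (n : ℕ) :
    (lookAndSay^[n] w).getLast? = w.getLast? := by
  induction n with
  | zero => rfl
  | succ n ih => rw [Function.iterate_succ_apply', lookAndSay_getLast, ih]

/-- Splitting Theorem: for nonempty `u, v` whose concatenation contains no four
consecutive equal symbols and no two adjacent symbols both exceeding 3, if the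
splitting condition holds up to nine derivations, then it holds forever. -/
theorem splitting_theorem (u v : List ℕ+) (hu : u ≠ []) (hv : v ≠ [])
    (h4 : ∀ a : ℕ+, ¬ [a, a, a, a] <:+: (u ++ v))
    (hbig : ∀ a b : ℕ+, [a, b] <:+: (u ++ v) → a ≤ 3 ∨ b ≤ 3)
    (h9 : ∀ k : ℕ, k ≤ 9 → lookAndSay^[k] (u ++ v) = lookAndSay^[k] u ++ lookAndSay^[k] v) :
    ∀ n : ℕ, lookAndSay^[n] (u ++ v) = lookAndSay^[n] u ++ lookAndSay^[n] v := by
  obtain ⟨l, hl⟩ : ∃ l, u.getLast? = some l := by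
    cases h : u.getLast? with
    | none => simp at h; exact absurd h hu
    | some l => exact ⟨l, rfl⟩
  have hV : LSV (v.map LSg) = true :=
    LSV_of_hyp v (fun a h => h4 a (h.trans (List.suffix_append _ _).isInfix))
      (fun a b h => hbig a b (h.trans (List.suffix_append _ _).isInfix))
  have hb : ∀ k ≤ 8, (lookAndSay^[k] v).head? ≠ some l := by
    intro k hk h
    have h1 := h9 (k + 1) (by omega)
    rw [Function.iterate_succ_apply', Function.iterate_succ_apply', Function.iterate_succ_apply',
      h9 k (by omega)] at h1
    exact lookAndSay_merge ((lookAndSay_iter_getLast u k).trans hl) h h1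
  have hhead : ∀ (k : ℕ) (b : ℕ+), (lookAndSay^[k] v).head? = some b →
      ((LSD false)^[k] (v.map LSg)).headD 0 = LSg b := by
    intro k b h
    rw [← (LSbridge_iter hV k).1]
    obtain ⟨s, hs⟩ := List.head?_eq_some_iff.1 h
    simp [hs]
  have hne : ∀ k, lookAndSay^[k] v ≠ [] := by
    intro k
    induction k with
    | zero => exact hv
    | succ k ih => rw [Function.iterate_succ_apply']; exact lookAndSay_ne_nil ih
  have hall : ∀ n, (lookAndSay^[n] v).head? ≠ some l := by
    intro n hn
    have hn' := hhead n l hn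
    by_cases hl4 : LSg l = 4
    · rcases n with _ | n
      · exact hb 0 (by omega) hn
      · rw [Function.iterate_succ_apply', ← (LSbridge_iter hV n).1] at hn'
        have := LSD_head_le (LSbridge_iter hV n).2
        omega
    · have hlp := l.pos
      refine LS_main (v.map LSg) hV (by simpa using hv) (LSg l) (by unfold LSg; omega)
        (by unfold LSg at hl4 ⊢; omega) (by simp) ?_ n hn'
      intro k hk h
      obtain ⟨b, s, hs⟩ := List.exists_cons_of_ne_nil (hne k)
      have hbs : (lookAndSay^[k] v).head? = some b := by simp [hs]
      have := LSg_inj (h.symm.trans (hhead k b hbs)) hl4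
      subst this
      exact hb k hk hbs
  intro n
  induction n with
  | zero => rfl
  | succ n ih =>
    rw [Function.iterate_succ_apply', Function.iterate_succ_apply', Function.iterate_succ_apply',
      ih, lookAndSay_append]
    intro a ha b hb' hab
    rw [Option.mem_def, lookAndSay_iter_getLast, hl] at ha
    simp at ha
    subst ha hab
    exact hall n hb'
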